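/- Let u : ℝ² → ℝ² be a smooth vector field, 2π-periodic in each variable, with each component having mean value zero over T² = [0,2π]². Then sup_{x∈T²} |u(x)|² ≤ (1/π) · ‖u‖ · ‖Δu‖; that is, the vector-valued Agmon inequality ‖u‖_∞ ≤ c ‖u‖^{1/2} ‖Δu‖^{1/2} holds with the same constant c² < 1/π as in the scalar case. -/

import Mathlib

open MeasureTheory Real

/-- First partial derivative of a function on `ℝ²`. -/
noncomputable def pd1 (f : ℝ × ℝ → ℝ) (p : ℝ × ℝ) : ℝ :=
  deriv (fun s => f (s, p.2)) p.1

/-- Second partial derivative of a function on `ℝ²`. -/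
noncomputable def pd2 (f : ℝ × ℝ → ℝ) (p : ℝ × ℝ) : ℝ :=
  deriv (fun s => f (p.1, s)) p.2

/-- The Laplacian `Δf = ∂₁²f + ∂₂²f`. -/
noncomputable def lap (f : ℝ × ℝ → ℝ) (p : ℝ × ℝ) : ℝ :=
  pd1 (pd1 f) p + pd2 (pd2 f) p

/-- The square torus `T² = [0,2π]²` (a fundamental cell). -/
noncomputable def cell2 : Set (ℝ × ℝ) :=
  Set.Icc (0 : ℝ) (2 * π) ×ˢ Set.Icc (0 : ℝ) (2 * π)

/-- Shell enumeration of the quarter lattice `{(a, b) | 1 ≤ a, 0 ≤ b}`: the points with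
`max a b = m` get the numbers from `m² - m + 1` to `m² + m`. -/
def quarterIndex (a b : ℤ) : ℤ :=
  if b ≤ a then a ^ 2 - a + (if b = 0 then 1 else 2 * b) else b ^ 2 - b + 2 * a + 1

theorem one_le_quarterIndex {a b : ℤ} (ha : 1 ≤ a) (hb : 0 ≤ b) : 1 ≤ quarterIndex a b := by
  unfold quarterIndex
  split_ifs
  · nlinarith
  · have : 1 ≤ b := by omega
    nlinarith
  · nlinarith

theorem quarterIndex_le {a b : ℤ} (ha : 1 ≤ a) :
    quarterIndex a b ≤ a ^ 2 + b ^ 2 := by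
  unfold quarterIndex
  split_ifs
  · nlinarith
  · nlinarith [sq_nonneg (b - 1)]
  · nlinarith [sq_nonneg (a - 1)]

theorem exists_quarterIndex_eq {a b : ℤ} (ha : 1 ≤ a) (hb : 0 ≤ b) :
    ∃ j, quarterIndex a b = max a b ^ 2 - max a b + j ∧ 1 ≤ j ∧ j ≤ 2 * max a b := by
  unfold quarterIndex
  split_ifs with h h0
  · exact ⟨1, by rw [max_eq_left h], le_rfl, by rw [max_eq_left h]; omega⟩
  · exact ⟨2 * b, by rw [max_eq_left h], by omega, by rw [max_eq_left h]; omega⟩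
  · rw [max_eq_right (by omega)]
    exact ⟨2 * a + 1, by ring, by omega, by omega⟩

theorem quarterIndex_inj {a b a' b' : ℤ} (ha : 1 ≤ a) (hb : 0 ≤ b) (ha' : 1 ≤ a') (hb' : 0 ≤ b')
    (h : quarterIndex a b = quarterIndex a' b') : a = a' ∧ b = b' := by
  have hm : max a b = max a' b' := by
    obtain ⟨j, hj, hj1, hj2⟩ := exists_quarterIndex_eq ha hb
    obtain ⟨j', hj', hj1', hj2'⟩ := exists_quarterIndex_eq ha' hb'
    have h1 : 1 ≤ max a b := le_max_of_le_left ha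
    have h1' : 1 ≤ max a' b' := le_max_of_le_left ha'
    generalize max a b = m at *
    generalize max a' b' = m' at *
    rcases lt_trichotomy m m' with hlt | heq | hlt
    · nlinarith
    · exact heq
    · nlinarith
  unfold quarterIndex at h
  rcases le_or_gt b a with h1 | h1 <;> rcases le_or_gt b' a' with h2 | h2
  · rw [max_eq_left h1, max_eq_left h2] at hm
    subst hm
    rw [if_pos h1, if_pos h2] at h
    split_ifs at h <;> omega
  · rw [max_eq_left h1, max_eq_right h2.le] at hm
    subst hm
    rw [if_pos h1, if_neg h2.not_ge] at h
    split_ifs at h <;> omega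
  · rw [max_eq_right h1.le, max_eq_left h2] at hm
    subst hm
    rw [if_neg h1.not_ge, if_pos h2] at h
    split_ifs at h <;> omega
  · rw [max_eq_right h1.le, max_eq_right h2.le] at hm
    subst hm
    rw [if_neg h1.not_ge, if_neg h2.not_ge] at h
    omega

theorem sum_inv_sq_add_sq_le {μ : ℝ} (hμ : 0 < μ) (N : ℕ) :
    ∑ n ∈ Finset.range N, (1 : ℝ) / (μ ^ 2 + ((n : ℝ) + 1) ^ 2) ≤ π / (2 * μ) := by
  have hanti : AntitoneOn (fun x : ℝ => 1 / (μ ^ 2 + x ^ 2)) (Set.Icc ((0 : ℕ) : ℝ) N) := by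
    intro x hx y _ hxy
    have : 0 ≤ x := by simpa using hx.1
    dsimp only
    gcongr
  have h := hanti.sum_le_integral_Ico (Nat.zero_le N)
  rw [← Finset.range_eq_Ico] at h
  push_cast at h
  refine h.trans ?_
  have hderiv : ∀ x : ℝ, HasDerivAt (fun x => arctan (x / μ) / μ) (1 / (μ ^ 2 + x ^ 2)) x := by
    intro x
    have := (((hasDerivAt_id x).div_const μ).arctan).div_const μ
    convert! this using 1
    simp only [id]
    field_simp
  rw [intervalIntegral.integral_eq_sub_of_hasDerivAt (fun x _ => hderiv x)]
  · simp only [zero_div, arctan_zero, sub_zero]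
    rw [← div_div]
    gcongr
    exact (arctan_lt_pi_div_two _).le
  · apply Continuous.intervalIntegrable
    refine continuous_const.div (by fun_prop) fun x => by positivity

theorem sum_inv_sq_add_sq_le_of_injOn {ι : Type*} {μ : ℝ} (hμ : 0 < μ) (s : Finset ι)
    (φ q : ι → ℤ) (hφ : Set.InjOn φ s) (h1 : ∀ i ∈ s, 1 ≤ φ i) (h2 : ∀ i ∈ s, φ i ≤ q i) :
    ∑ i ∈ s, (1 : ℝ) / (μ ^ 2 + (q i : ℝ) ^ 2) ≤ π / (2 * μ) := by
  obtain ⟨N, hN⟩ : ∃ N : ℕ, ∀ i ∈ s, (φ i - 1).toNat < N := by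
    refine ⟨s.sup (fun i => (φ i - 1).toNat) + 1, fun i hi => Nat.lt_succ_of_le ?_⟩
    exact Finset.le_sup (f := fun i => (φ i - 1).toNat) hi
  refine le_trans ?_ (sum_inv_sq_add_sq_le hμ N)
  have hinj : Set.InjOn (fun i => (φ i - 1).toNat) s := by
    intro i hi j hj hij
    have := h1 i hi
    have := h1 j hj
    dsimp only at hij
    exact hφ hi hj (by omega)
  calc ∑ i ∈ s, (1 : ℝ) / (μ ^ 2 + (q i : ℝ) ^ 2)
      ≤ ∑ i ∈ s, (1 : ℝ) / (μ ^ 2 + (((φ i - 1).toNat : ℝ) + 1) ^ 2) := by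
        refine Finset.sum_le_sum fun i hi => ?_
        have h : (((φ i - 1).toNat : ℝ) + 1) = (φ i : ℝ) := by
          have : (((φ i - 1).toNat : ℤ)) = φ i - 1 := Int.toNat_of_nonneg (by have := h1 i hi; omega)
          have : ((((φ i - 1).toNat : ℤ)) : ℝ) = ((φ i - 1 : ℤ) : ℝ) := by rw [this]
          push_cast at this
          linarith
        rw [h]
        have ha : (1 : ℝ) ≤ φ i := by exact_mod_cast h1 i hi
        have hb : (φ i : ℝ) ≤ q i := by exact_mod_cast h2 i hi
        gcongr
    _ = ∑ n ∈ s.image (fun i => (φ i - 1).toNat), (1 : ℝ) / (μ ^ 2 + ((n : ℝ) + 1) ^ 2) := by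
        rw [Finset.sum_image hinj]
    _ ≤ _ := by
        refine Finset.sum_le_sum_of_subset_of_nonneg ?_ fun n _ _ => by positivity
        intro n hn
        obtain ⟨i, hi, rfl⟩ := Finset.mem_image.1 hn
        exact Finset.mem_range.2 (hN i hi)

theorem sum_quarter_le {ι : Type*} {μ : ℝ} (hμ : 0 < μ) (s : Finset ι)
    (a b : ι → ℤ) (ha : ∀ i ∈ s, 1 ≤ a i) (hb : ∀ i ∈ s, 0 ≤ b i)
    (hinj : ∀ i j, a i = a j → b i = b j → i = j) :
    ∑ i ∈ s, (1 : ℝ) / (μ ^ 2 + ((a i : ℝ) ^ 2 + (b i : ℝ) ^ 2) ^ 2) ≤ π / (2 * μ) := by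
  have := sum_inv_sq_add_sq_le_of_injOn hμ s (fun i => quarterIndex (a i) (b i))
    (fun i => a i ^ 2 + b i ^ 2) ?_ (fun i hi => one_le_quarterIndex (ha i hi) (hb i hi))
    (fun i hi => quarterIndex_le (ha i hi))
  · exact_mod_cast this
  · intro i hi j hj h
    obtain ⟨h1, h2⟩ := quarterIndex_inj (ha i hi) (hb i hi) (ha j hj) (hb j hj) h
    exact hinj i j h1 h2

/-- The lattice sum `∑_{k ≠ 0} 1 / (μ² + |k|⁴)` over `ℤ²` is at most `2π / μ`. -/
theorem sum_lattice_le {μ : ℝ} (hμ : 0 < μ) (s : Finset (Fin 2 → ℤ)) (hs : 0 ∉ s) :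
    ∑ k ∈ s, (1 : ℝ) / (μ ^ 2 + ((k 0 : ℝ) ^ 2 + (k 1 : ℝ) ^ 2) ^ 2) ≤ 2 * π / μ := by
  classical
  have key : ∀ x y : (Fin 2 → ℤ) → ℤ,
      (∀ k, (x k : ℝ) ^ 2 + (y k : ℝ) ^ 2 = (k 0 : ℝ) ^ 2 + (k 1 : ℝ) ^ 2) →
      (∀ k l, x k = x l → y k = y l → k = l) →
      ∑ k ∈ s with 1 ≤ x k ∧ 0 ≤ y k,
        (1 : ℝ) / (μ ^ 2 + ((k 0 : ℝ) ^ 2 + (k 1 : ℝ) ^ 2) ^ 2) ≤ π / (2 * μ) := by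
    intro x y hxy hinj
    have := sum_quarter_le hμ (s.filter fun k => 1 ≤ x k ∧ 0 ≤ y k) x y
      (fun k hk => (Finset.mem_filter.1 hk).2.1) (fun k hk => (Finset.mem_filter.1 hk).2.2) hinj
    simpa only [hxy] using this
  have h1 := key (fun k => k 0) (fun k => k 1) (fun k => rfl)
    (fun k l h h' => by ext i; fin_cases i <;> assumption)
  have h2 := key (fun k => k 1) (fun k => - k 0) (fun k => by push_cast; ring)
    (fun k l h h' => by ext i; fin_cases i <;> simp_all)
  have h3 := key (fun k => - k 0) (fun k => - k 1) (fun k => by push_cast; ring)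
    (fun k l h h' => by ext i; fin_cases i <;> simp_all)
  have h4 := key (fun k => - k 1) (fun k => k 0) (fun k => by push_cast; ring)
    (fun k l h h' => by ext i; fin_cases i <;> simp_all)
  have hsplit : ∀ g : (Fin 2 → ℤ) → ℝ, ∑ k ∈ s, g k =
      ∑ k ∈ s with 1 ≤ k 0 ∧ 0 ≤ k 1, g k + ∑ k ∈ s with 1 ≤ k 1 ∧ 0 ≤ - k 0, g k
      + ∑ k ∈ s with 1 ≤ - k 0 ∧ 0 ≤ - k 1, g k + ∑ k ∈ s with 1 ≤ - k 1 ∧ 0 ≤ k 0, g k := by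
    intro g
    simp only [Finset.sum_filter, ← Finset.sum_add_distrib]
    refine Finset.sum_congr rfl fun k hk => ?_
    have hk0 : ¬ (k 0 = 0 ∧ k 1 = 0) := by
      rintro ⟨h0, h1⟩
      apply hs
      convert hk
      ext i
      fin_cases i <;> simp_all
    split_ifs <;> first | omega | simp
  rw [hsplit]
  have : 2 * π / μ = π / (2 * μ) + π / (2 * μ) + π / (2 * μ) + π / (2 * μ) := by
    field_simp; ring
  linarith

/-- Carlson-type inequality: `∑ c ≤ √(4π) A^{1/4} B^{1/4}` for `A = ∑ c²`, `B = ∑ |k|⁴ c²`. -/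
theorem sq_sum_le_of_lattice {A B : ℝ} (s : Finset (Fin 2 → ℤ)) (hs : 0 ∉ s)
    (c : (Fin 2 → ℤ) → ℝ) (hA : ∑ k ∈ s, c k ^ 2 ≤ A)
    (hB : ∑ k ∈ s, (((k 0 : ℝ) ^ 2 + (k 1 : ℝ) ^ 2) * c k) ^ 2 ≤ B) :
    (∑ k ∈ s, c k) ^ 2 ≤ 4 * π * (√A * √B) := by
  have hA0 : 0 ≤ A := (Finset.sum_nonneg fun k _ => sq_nonneg (c k)).trans hA
  have hB0 : 0 ≤ B := (Finset.sum_nonneg fun k _ => sq_nonneg _).trans hB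
  have hq : ∀ k ∈ s, (1 : ℝ) ≤ (k 0 : ℝ) ^ 2 + (k 1 : ℝ) ^ 2 := by
    intro k hk
    have : (1 : ℤ) ≤ k 0 ^ 2 + k 1 ^ 2 := by
      by_contra! hlt
      have h0 : k 0 = 0 := by nlinarith [sq_nonneg (k 0), sq_nonneg (k 1)]
      have h1 : k 1 = 0 := by nlinarith [sq_nonneg (k 0), sq_nonneg (k 1)]
      apply hs
      convert hk
      ext i
      fin_cases i <;> simp_all
    exact_mod_cast this
  have hzero : (∑ k ∈ s, c k ^ 2 ≤ 0) → (∑ k ∈ s, c k) ^ 2 ≤ 4 * π * (√A * √B) := by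
    intro h
    have h' := (Finset.sum_eq_zero_iff_of_nonneg fun k _ => sq_nonneg (c k)).1
      (le_antisymm h (Finset.sum_nonneg fun k _ => sq_nonneg (c k)))
    rw [Finset.sum_eq_zero fun k hk => pow_eq_zero_iff two_ne_zero |>.1 (h' k hk),
      zero_pow two_ne_zero]
    positivity
  rcases hA0.eq_or_lt with rfl | hApos
  · exact hzero hA
  rcases hB0.eq_or_lt with rfl | hBpos
  · refine hzero (le_trans (Finset.sum_le_sum fun k hk => ?_) hB)
    rw [mul_pow]
    exact le_mul_of_one_le_left (sq_nonneg _) (one_le_pow₀ (hq k hk))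
  set μ := √B / √A with hμdef
  have ha := sqrt_pos.2 hApos
  have hb := sqrt_pos.2 hBpos
  have hμ : 0 < μ := div_pos hb ha
  have hCS := Finset.sum_sq_le_sum_mul_sum_of_sq_le_mul s (r := c)
    (f := fun k => 1 / (μ ^ 2 + ((k 0 : ℝ) ^ 2 + (k 1 : ℝ) ^ 2) ^ 2))
    (g := fun k => (μ ^ 2 + ((k 0 : ℝ) ^ 2 + (k 1 : ℝ) ^ 2) ^ 2) * c k ^ 2)
    (fun k _ => by positivity) (fun k _ => by positivity)
    (fun k _ => by
      have : 0 < μ ^ 2 + ((k 0 : ℝ) ^ 2 + (k 1 : ℝ) ^ 2) ^ 2 := by positivity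
      field_simp; rfl)
  refine hCS.trans ?_
  have h2 : ∑ k ∈ s, (μ ^ 2 + ((k 0 : ℝ) ^ 2 + (k 1 : ℝ) ^ 2) ^ 2) * c k ^ 2 ≤ μ ^ 2 * A + B := by
    calc _ = μ ^ 2 * ∑ k ∈ s, c k ^ 2 +
          ∑ k ∈ s, (((k 0 : ℝ) ^ 2 + (k 1 : ℝ) ^ 2) * c k) ^ 2 := by
          rw [Finset.mul_sum, ← Finset.sum_add_distrib]
          exact Finset.sum_congr rfl fun k _ => by ring
      _ ≤ _ := by gcongr
  calc _ ≤ (2 * π / μ) * (μ ^ 2 * A + B) :=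
        mul_le_mul (sum_lattice_le hμ s hs) h2 (Finset.sum_nonneg fun k _ => by positivity)
          (by positivity)
    _ = 4 * π * (√A * √B) := by
        have hA' : A = √A ^ 2 := (sq_sqrt hA0).symm
        have hB' : B = √B ^ 2 := (sq_sqrt hB0).symm
        generalize √A = x at *
        generalize √B = y at *
        rw [hμdef, hA', hB']
        field_simp
        ring

attribute [local instance] instMeasureSpaceUnitAddCircle

/-- The covering map `ℝ² → ℝ²/ℤ²` rescaled to `2π`-periodic coordinates. -/
noncomputable def torusMk (p : ℝ × ℝ) : UnitAddTorus (Fin 2) :=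
  ![((p.1 / (2 * π) : ℝ) : UnitAddCircle), ((p.2 / (2 * π) : ℝ) : UnitAddCircle)]

theorem isOpenQuotientMap_torusMk : IsOpenQuotientMap torusMk := by
  have h1 : IsOpenQuotientMap (Pi.map fun (_ : Fin 2) (x : ℝ) => (x : UnitAddCircle)) :=
    IsOpenQuotientMap.piMap fun _ => QuotientAddGroup.isOpenQuotientMap_mk
  let e : ℝ ≃ₜ ℝ := Homeomorph.mulRight₀ ((2 * π)⁻¹) (by positivity)
  have h2 := h1.comp ((e.prodCongr e).trans Homeomorph.finTwoArrow.symm).isOpenQuotientMap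
  convert h2 using 1
  ext p i
  fin_cases i <;> rfl

theorem exists_torus_lift {E : Type*} [TopologicalSpace E] {f : ℝ × ℝ → E} (hf : Continuous f)
    (hper1 : ∀ p : ℝ × ℝ, f (p.1 + 2 * π, p.2) = f p)
    (hper2 : ∀ p : ℝ × ℝ, f (p.1, p.2 + 2 * π) = f p) :
    ∃ F : C(UnitAddTorus (Fin 2), E), ∀ p, F (torusMk p) = f p := by
  let Q : C(ℝ × ℝ, UnitAddTorus (Fin 2)) := ⟨torusMk, isOpenQuotientMap_torusMk.continuous⟩
  have hQ : Topology.IsQuotientMap Q := isOpenQuotientMap_torusMk.isQuotientMap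
  have key : Function.FactorsThrough (⟨f, hf⟩ : C(ℝ × ℝ, E)) Q := by
    intro p q h
    have hshift : ∀ x y : ℝ, ((x / (2 * π) : ℝ) : UnitAddCircle) = ((y / (2 * π) : ℝ)) →
        ∃ n : ℤ, x = y + n * (2 * π) := by
      intro x y hxy
      rw [← sub_eq_zero, ← AddCircle.coe_sub, AddCircle.coe_eq_zero_iff] at hxy
      obtain ⟨n, hn⟩ := hxy
      refine ⟨n, ?_⟩
      rw [zsmul_eq_mul, mul_one] at hn
      rw [hn]
      field_simp
      ring
    obtain ⟨m, hm⟩ := hshift p.1 q.1 (congrFun h 0)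
    obtain ⟨n, hn⟩ := hshift p.2 q.2 (congrFun h 1)
    have e1 : Function.Periodic (fun x => f (x, p.2)) (2 * π) := fun x => hper1 (x, p.2)
    have e2 : Function.Periodic (fun y => f (q.1, y)) (2 * π) := fun y => hper2 (q.1, y)
    calc f p = f (q.1 + m * (2 * π), p.2) := by rw [← hm]
      _ = f (q.1, p.2) := e1.int_mul m q.1
      _ = f (q.1, q.2 + n * (2 * π)) := by rw [← hn]
      _ = f q := e2.int_mul n q.2
  refine ⟨hQ.lift ⟨f, hf⟩ key, fun p => ?_⟩
  exact congrFun (congrArg DFunLike.coe (hQ.lift_comp ⟨f, hf⟩ key)) p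

theorem integrableOn_cell2 {E : Type*} [NormedAddCommGroup E] {f : ℝ × ℝ → E}
    (hf : Continuous f) : IntegrableOn f cell2 :=
  hf.continuousOn.integrableOn_compact (isCompact_Icc.prod isCompact_Icc)

theorem setIntegral_cell2 {E : Type*} [NormedAddCommGroup E] [NormedSpace ℝ E]
    {f : ℝ × ℝ → E} (hf : Continuous f) :
    ∫ p in cell2, f p = ∫ x in (0 : ℝ)..2 * π, ∫ y in (0 : ℝ)..2 * π, f (x, y) := by
  rw [cell2, Measure.volume_eq_prod, setIntegral_prod]
  · simp only [intervalIntegral.integral_of_le two_pi_pos.le, integral_Icc_eq_integral_Ioc]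
  · exact integrableOn_cell2 hf

theorem setIntegral_cell2_swap {E : Type*} [NormedAddCommGroup E] [NormedSpace ℝ E]
    {f : ℝ × ℝ → E} (hf : Continuous f) :
    ∫ p in cell2, f p = ∫ y in (0 : ℝ)..2 * π, ∫ x in (0 : ℝ)..2 * π, f (x, y) := by
  refine Eq.trans ?_ (setIntegral_cell2 (hf.comp continuous_swap))
  rw [cell2, Measure.volume_eq_prod]
  exact (setIntegral_prod_swap _ _ f).symm

theorem integral_torus {E : Type*} [NormedAddCommGroup E] [NormedSpace ℝ E]
    (G : UnitAddTorus (Fin 2) → E) (f : ℝ × ℝ → E) (hf : Continuous f)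
    (hG : ∀ p, G (torusMk p) = f p) :
    ∫ t, G t = ((2 * π) ^ 2)⁻¹ • ∫ p in cell2, f p := by
  rw [setIntegral_cell2 hf, UnitAddTorus.integral_preimage G 0]
  have hset : MeasurableEquiv.finTwoArrow (α := ℝ) ⁻¹' (Set.Ioc 0 1 ×ˢ Set.Ioc 0 1) =
      {x : Fin 2 → ℝ | ∀ i, x i ∈ Set.Ioc ((0 : Fin 2 → ℝ) i) ((0 : Fin 2 → ℝ) i + 1)} := by
    ext x
    simp [Fin.forall_fin_two]
  have h := (volume_preserving_finTwoArrow ℝ).setIntegral_preimage_emb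
    MeasurableEquiv.finTwoArrow.measurableEmbedding
    (fun p => f (2 * π * p.1, 2 * π * p.2)) (Set.Ioc 0 1 ×ˢ Set.Ioc 0 1)
  rw [hset] at h
  have hcont : Continuous fun p : ℝ × ℝ => f (2 * π * p.1, 2 * π * p.2) := by fun_prop
  calc _ = ∫ p in Set.Ioc (0 : ℝ) 1 ×ˢ Set.Ioc (0 : ℝ) 1, f (2 * π * p.1, 2 * π * p.2) := by
        rw [← h]
        congr 1
        ext x
        rw [← hG]
        congr 1
        ext i
        fin_cases i <;> simp [torusMk, MeasurableEquiv.finTwoArrow, pi_ne_zero]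
    _ = ∫ x in (0 : ℝ)..1, ∫ y in (0 : ℝ)..1, f (2 * π * x, 2 * π * y) := by
        rw [Measure.volume_eq_prod, setIntegral_prod]
        · simp only [intervalIntegral.integral_of_le zero_le_one]
        · exact (hcont.continuousOn.integrableOn_compact
            (isCompact_Icc.prod isCompact_Icc)).mono_set
            (Set.prod_mono Set.Ioc_subset_Icc_self Set.Ioc_subset_Icc_self)
    _ = _ := by
        have hπ : 2 * π ≠ 0 := by positivity
        have h1 : ∀ x, ∫ y in (0 : ℝ)..1, f (2 * π * x, 2 * π * y) =
            (2 * π)⁻¹ • ∫ y in (0 : ℝ)..2 * π, f (2 * π * x, y) := fun x => by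
          rw [intervalIntegral.integral_comp_mul_left (fun y => f (2 * π * x, y)) hπ]
          simp
        simp only [h1, intervalIntegral.integral_smul]
        rw [intervalIntegral.integral_comp_mul_left
          (fun x => ∫ y in (0 : ℝ)..2 * π, f (x, y)) hπ]
        simp only [mul_zero, mul_one, smul_smul]
        congr 1
        field_simp

/-- The exponential `e^{-i(mx + ny)}`. -/
noncomputable def waveConj (k : Fin 2 → ℤ) (p : ℝ × ℝ) : ℂ :=
  Complex.exp (-(k 0 * p.1 * Complex.I)) * Complex.exp (-(k 1 * p.2 * Complex.I))

theorem mFourier_neg_torusMk (k : Fin 2 → ℤ) (p : ℝ × ℝ) :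
    UnitAddTorus.mFourier (-k) (torusMk p) = waveConj k p := by
  have hπ : (π : ℂ) ≠ 0 := by exact_mod_cast pi_ne_zero
  simp only [UnitAddTorus.mFourier, ContinuousMap.coe_mk, Fin.prod_univ_two, torusMk, waveConj,
    Matrix.cons_val_zero, Matrix.cons_val_one, fourier_coe_apply, Pi.neg_apply]
  congr 2 <;> (push_cast; field_simp)

theorem bessel_torus (F : C(UnitAddTorus (Fin 2), ℂ)) (s : Finset (Fin 2 → ℤ)) :
    ∑ k ∈ s, ‖UnitAddTorus.mFourierCoeff F k‖ ^ 2 ≤ ∫ t, ‖F t‖ ^ 2 := by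
  have : IsProbabilityMeasure (volume : Measure UnitAddCircle) :=
    inferInstanceAs (IsProbabilityMeasure AddCircle.haarAddCircle)
  have h := UnitAddTorus.hasSum_sq_mFourierCoeff (ContinuousMap.toLp 2 volume ℂ F)
  simp only [UnitAddTorus.mFourierCoeff_toLp] at h
  have h2 : ∫ t, ‖ContinuousMap.toLp 2 volume ℂ F t‖ ^ 2 = ∫ t, ‖F t‖ ^ 2 := by
    refine integral_congr_ae ?_
    filter_upwards [ContinuousMap.coeFn_toLp (p := 2) (𝕜 := ℂ) volume F] with t ht
    rw [ht]
  rw [h2] at h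
  exact sum_le_hasSum s (fun k _ => sq_nonneg _) h

theorem continuous_waveConj (k : Fin 2 → ℤ) : Continuous (waveConj k) := by
  unfold waveConj
  fun_prop

theorem hasDerivAt_slice_fst {f : ℝ × ℝ → ℝ} (hf : Differentiable ℝ f) (x y : ℝ) :
    HasDerivAt (fun s => f (s, y)) (fderiv ℝ f (x, y) (1, 0)) x :=
  (hf (x, y)).hasFDerivAt.comp_hasDerivAt x ((hasDerivAt_id x).prodMk (hasDerivAt_const x y))

theorem hasDerivAt_slice_snd {f : ℝ × ℝ → ℝ} (hf : Differentiable ℝ f) (x y : ℝ) :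
    HasDerivAt (fun s => f (x, s)) (fderiv ℝ f (x, y) (0, 1)) y :=
  (hf (x, y)).hasFDerivAt.comp_hasDerivAt y ((hasDerivAt_const y x).prodMk (hasDerivAt_id y))

theorem hasDerivAt_pd1 {f : ℝ × ℝ → ℝ} (hf : ContDiff ℝ (⊤ : ℕ∞) f) (x y : ℝ) :
    HasDerivAt (fun s => f (s, y)) (pd1 f (x, y)) x :=
  (hasDerivAt_slice_fst (hf.differentiable (by simp)) x y).differentiableAt.hasDerivAt

theorem hasDerivAt_pd2 {f : ℝ × ℝ → ℝ} (hf : ContDiff ℝ (⊤ : ℕ∞) f) (x y : ℝ) :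
    HasDerivAt (fun s => f (x, s)) (pd2 f (x, y)) y :=
  (hasDerivAt_slice_snd (hf.differentiable (by simp)) x y).differentiableAt.hasDerivAt

theorem contDiff_pd1 {f : ℝ × ℝ → ℝ} (hf : ContDiff ℝ (⊤ : ℕ∞) f) :
    ContDiff ℝ (⊤ : ℕ∞) (pd1 f) := by
  have h : pd1 f = fun p => fderiv ℝ f p (1, 0) := by
    ext p
    exact (hasDerivAt_slice_fst (hf.differentiable (by simp)) p.1 p.2).deriv
  rw [h]
  exact (hf.fderiv_right (by simp)).clm_apply contDiff_const

theorem contDiff_pd2 {f : ℝ × ℝ → ℝ} (hf : ContDiff ℝ (⊤ : ℕ∞) f) :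
    ContDiff ℝ (⊤ : ℕ∞) (pd2 f) := by
  have h : pd2 f = fun p => fderiv ℝ f p (0, 1) := by
    ext p
    exact (hasDerivAt_slice_snd (hf.differentiable (by simp)) p.1 p.2).deriv
  rw [h]
  exact (hf.fderiv_right (by simp)).clm_apply contDiff_const

theorem continuous_lap {f : ℝ × ℝ → ℝ} (hf : ContDiff ℝ (⊤ : ℕ∞) f) : Continuous (lap f) :=
  (contDiff_pd1 (contDiff_pd1 hf)).continuous.add (contDiff_pd2 (contDiff_pd2 hf)).continuous

theorem pd1_add_fst {f : ℝ × ℝ → ℝ} {c : ℝ} (h : ∀ p : ℝ × ℝ, f (p.1 + c, p.2) = f p)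
    (p : ℝ × ℝ) : pd1 f (p.1 + c, p.2) = pd1 f p := by
  unfold pd1
  rw [← deriv_comp_add_const]
  exact congrArg (deriv · p.1) (funext fun s => h (s, p.2))

theorem pd1_add_snd {f : ℝ × ℝ → ℝ} {c : ℝ} (h : ∀ p : ℝ × ℝ, f (p.1, p.2 + c) = f p)
    (p : ℝ × ℝ) : pd1 f (p.1, p.2 + c) = pd1 f p :=
  congrArg (deriv · p.1) (funext fun s => h (s, p.2))

theorem pd2_add_snd {f : ℝ × ℝ → ℝ} {c : ℝ} (h : ∀ p : ℝ × ℝ, f (p.1, p.2 + c) = f p)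
    (p : ℝ × ℝ) : pd2 f (p.1, p.2 + c) = pd2 f p := by
  unfold pd2
  rw [← deriv_comp_add_const]
  exact congrArg (deriv · p.2) (funext fun s => h (p.1, s))

theorem pd2_add_fst {f : ℝ × ℝ → ℝ} {c : ℝ} (h : ∀ p : ℝ × ℝ, f (p.1 + c, p.2) = f p)
    (p : ℝ × ℝ) : pd2 f (p.1 + c, p.2) = pd2 f p :=
  congrArg (deriv · p.2) (funext fun s => h (p.1, s))

theorem lap_add_fst {f : ℝ × ℝ → ℝ} {c : ℝ} (h : ∀ p : ℝ × ℝ, f (p.1 + c, p.2) = f p)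
    (p : ℝ × ℝ) : lap f (p.1 + c, p.2) = lap f p :=
  congrArg₂ (· + ·) (pd1_add_fst (pd1_add_fst h) p) (pd2_add_fst (pd2_add_fst h) p)

theorem lap_add_snd {f : ℝ × ℝ → ℝ} {c : ℝ} (h : ∀ p : ℝ × ℝ, f (p.1, p.2 + c) = f p)
    (p : ℝ × ℝ) : lap f (p.1, p.2 + c) = lap f p :=
  congrArg₂ (· + ·) (pd1_add_snd (pd1_add_snd h) p) (pd2_add_snd (pd2_add_snd h) p)

theorem hasDerivAt_exp_neg (n : ℤ) (x : ℝ) :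
    HasDerivAt (fun s : ℝ => Complex.exp (-(n * s * Complex.I)))
      (-(n * Complex.I) * Complex.exp (-(n * x * Complex.I))) x := by
  have h : HasDerivAt (fun s : ℝ => (-(n * s * Complex.I) : ℂ)) (-(n * Complex.I)) x := by
    have := (((hasDerivAt_id x).ofReal_comp).const_mul (n : ℂ)).mul_const Complex.I
    simpa [Pi.neg_def] using this.neg
  simpa [mul_comm] using h.cexp

theorem exp_neg_two_pi (n : ℤ) : Complex.exp (-(n * ((2 * π : ℝ) : ℂ) * Complex.I)) = 1 := by
  rw [Complex.exp_eq_one_iff]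
  exact ⟨-n, by push_cast; ring⟩

theorem integral_deriv_mul_exp {h h' : ℝ → ℝ} (hd : ∀ x, HasDerivAt h (h' x) x)
    (hc : Continuous h') (hper : h (2 * π) = h 0) (n : ℤ) :
    ∫ x in (0 : ℝ)..2 * π, (h' x : ℂ) * Complex.exp (-(n * x * Complex.I)) =
      (n * Complex.I) * ∫ x in (0 : ℝ)..2 * π, (h x : ℂ) * Complex.exp (-(n * x * Complex.I)) := by
  have key := intervalIntegral.integral_mul_deriv_eq_deriv_mul (a := 0) (b := 2 * π)
    (u := fun x : ℝ => Complex.exp (-(n * x * Complex.I))) (v := fun x => (h x : ℂ))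
    (v' := fun x => (h' x : ℂ)) (fun x _ => hasDerivAt_exp_neg n x)
    (fun x _ => (hd x).ofReal_comp) (Continuous.intervalIntegrable (by fun_prop) _ _)
    (Continuous.intervalIntegrable (by fun_prop) _ _)
  rw [exp_neg_two_pi, hper] at key
  simp only [mul_comm _ (Complex.exp _)]
  rw [key, ← intervalIntegral.integral_const_mul]
  simp [mul_assoc]

theorem integral_deriv_deriv_mul_exp {h h' h'' : ℝ → ℝ} (hd : ∀ x, HasDerivAt h (h' x) x)
    (hd' : ∀ x, HasDerivAt h' (h'' x) x) (hc : Continuous h'') (hper : h (2 * π) = h 0)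
    (hper' : h' (2 * π) = h' 0) (n : ℤ) :
    ∫ x in (0 : ℝ)..2 * π, (h'' x : ℂ) * Complex.exp (-(n * x * Complex.I)) =
      -(n : ℂ) ^ 2 * ∫ x in (0 : ℝ)..2 * π, (h x : ℂ) * Complex.exp (-(n * x * Complex.I)) := by
  have hc' : Continuous h' := continuous_iff_continuousAt.2 fun x => (hd' x).continuousAt
  rw [integral_deriv_mul_exp hd' hc hper', integral_deriv_mul_exp hd hc' hper, ← mul_assoc]
  congr 1
  linear_combination (n : ℂ) ^ 2 * Complex.I_sq

theorem integral_pd2_pd2_mul_waveConj {f : ℝ × ℝ → ℝ} (hf : ContDiff ℝ (⊤ : ℕ∞) f)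
    (hper2 : ∀ p : ℝ × ℝ, f (p.1, p.2 + 2 * π) = f p) (k : Fin 2 → ℤ) :
    ∫ p in cell2, (pd2 (pd2 f) p : ℂ) * waveConj k p =
      -(k 1 : ℂ) ^ 2 *
        ∫ p in cell2, (f p : ℂ) * waveConj k p := by
  have hw := continuous_waveConj k
  have hc := (contDiff_pd2 (contDiff_pd2 hf)).continuous
  have hfc := hf.continuous
  rw [setIntegral_cell2 (by fun_prop : Continuous
      fun p : ℝ × ℝ => (pd2 (pd2 f) p : ℂ) * waveConj k p),
    setIntegral_cell2 (by fun_prop : Continuous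
      fun p : ℝ × ℝ => (f p : ℂ) * waveConj k p), ← intervalIntegral.integral_const_mul]
  congr 1
  ext x
  have h := integral_deriv_deriv_mul_exp (fun y => hasDerivAt_pd2 hf x y)
    (fun y => hasDerivAt_pd2 (contDiff_pd2 hf) x y)
    (hc.comp (by fun_prop : Continuous fun y => (x, y)))
    (by simpa using hper2 (x, 0)) (by simpa using pd2_add_snd hper2 (x, 0)) (k 1)
  simp only [waveConj, mul_left_comm _ (Complex.exp (-(k 0 * x * Complex.I))),
    intervalIntegral.integral_const_mul]
  rw [h]

theorem integral_pd1_pd1_mul_waveConj {f : ℝ × ℝ → ℝ} (hf : ContDiff ℝ (⊤ : ℕ∞) f)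
    (hper1 : ∀ p : ℝ × ℝ, f (p.1 + 2 * π, p.2) = f p) (k : Fin 2 → ℤ) :
    ∫ p in cell2, (pd1 (pd1 f) p : ℂ) * waveConj k p =
      -(k 0 : ℂ) ^ 2 *
        ∫ p in cell2, (f p : ℂ) * waveConj k p := by
  have hw := continuous_waveConj k
  have hc := (contDiff_pd1 (contDiff_pd1 hf)).continuous
  have hfc := hf.continuous
  rw [setIntegral_cell2_swap (by fun_prop : Continuous
      fun p : ℝ × ℝ => (pd1 (pd1 f) p : ℂ) * waveConj k p),
    setIntegral_cell2_swap (by fun_prop : Continuous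
      fun p : ℝ × ℝ => (f p : ℂ) * waveConj k p), ← intervalIntegral.integral_const_mul]
  congr 1
  ext y
  have h := integral_deriv_deriv_mul_exp (fun x => hasDerivAt_pd1 hf x y)
    (fun x => hasDerivAt_pd1 (contDiff_pd1 hf) x y)
    (hc.comp (by fun_prop : Continuous fun x => (x, y)))
    (by simpa using hper1 (0, y)) (by simpa using pd1_add_fst hper1 (0, y)) (k 0)
  simp only [waveConj, ← mul_assoc, intervalIntegral.integral_mul_const]
  rw [h]

theorem integral_lap_mul_waveConj {f : ℝ × ℝ → ℝ} (hf : ContDiff ℝ (⊤ : ℕ∞) f)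
    (hper1 : ∀ p : ℝ × ℝ, f (p.1 + 2 * π, p.2) = f p)
    (hper2 : ∀ p : ℝ × ℝ, f (p.1, p.2 + 2 * π) = f p) (k : Fin 2 → ℤ) :
    ∫ p in cell2, (lap f p : ℂ) * waveConj k p =
      -((k 0 : ℂ) ^ 2 + (k 1 : ℂ) ^ 2) *
        ∫ p in cell2, (f p : ℂ) * waveConj k p := by
  have hw := continuous_waveConj k
  have hc1 := (contDiff_pd1 (contDiff_pd1 hf)).continuous
  have hc2 := (contDiff_pd2 (contDiff_pd2 hf)).continuous
  simp only [lap, Complex.ofReal_add, add_mul]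
  rw [integral_add (integrableOn_cell2 (by fun_prop)) (integrableOn_cell2 (by fun_prop)),
    integral_pd1_pd1_mul_waveConj hf hper1, integral_pd2_pd2_mul_waveConj hf hper2]
  ring

theorem setIntegral_waveConj_mul_add {a b : ℝ × ℝ → ℝ} (ha : Continuous a) (hb : Continuous b)
    (k : Fin 2 → ℤ) :
    ∫ p in cell2, waveConj k p * ((a p : ℂ) + b p * Complex.I) =
      (∫ p in cell2, (a p : ℂ) * waveConj k p) +
        Complex.I * ∫ p in cell2, (b p : ℂ) * waveConj k p := by
  have hw := continuous_waveConj k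
  rw [← integral_const_mul, ← integral_add (integrableOn_cell2 (by fun_prop))
    (integrableOn_cell2 (by fun_prop))]
  congr 1
  ext p
  ring

theorem mFourierCoeff_eq_setIntegral (F : UnitAddTorus (Fin 2) → ℂ) {f : ℝ × ℝ → ℂ}
    (hf : Continuous f) (hF : ∀ p, F (torusMk p) = f p) (k : Fin 2 → ℤ) :
    UnitAddTorus.mFourierCoeff F k =
      ((2 * π) ^ 2)⁻¹ • ∫ p in cell2, waveConj k p * f p := by
  have hw := continuous_waveConj k
  exact integral_torus (fun t => UnitAddTorus.mFourier (-k) t • F t)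
    (fun p => waveConj k p * f p) (by fun_prop)
    (fun p => by rw [mFourier_neg_torusMk, hF, smul_eq_mul])

/-- **Agmon inequality** on the torus, phrased in terms of Fourier coefficients: `G` plays the
role of `ΔF`. -/
theorem sq_norm_le_of_mFourierCoeff {A B : ℝ} (F G : C(UnitAddTorus (Fin 2), ℂ))
    (hA : ∫ t, ‖F t‖ ^ 2 = A) (hB : ∫ t, ‖G t‖ ^ 2 = B)
    (h0 : UnitAddTorus.mFourierCoeff F 0 = 0)
    (hG : ∀ k, UnitAddTorus.mFourierCoeff G k =
      -((k 0 : ℂ) ^ 2 + (k 1 : ℂ) ^ 2) * UnitAddTorus.mFourierCoeff F k)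
    (t : UnitAddTorus (Fin 2)) : ‖F t‖ ^ 2 ≤ 4 * π * (√A * √B) := by
  classical
  have hnorm : ∀ k : Fin 2 → ℤ, ‖UnitAddTorus.mFourierCoeff G k‖ =
      ((k 0 : ℝ) ^ 2 + (k 1 : ℝ) ^ 2) * ‖UnitAddTorus.mFourierCoeff F k‖ := fun k => by
    have hk : ((k 0 : ℂ) ^ 2 + (k 1 : ℂ) ^ 2) = (((k 0 : ℝ) ^ 2 + (k 1 : ℝ) ^ 2 : ℝ) : ℂ) := by
      push_cast
      rfl
    rw [hG, norm_mul, norm_neg, hk, Complex.norm_real, norm_of_nonneg (by positivity)]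
  have hsum : ∀ s : Finset (Fin 2 → ℤ),
      ∑ k ∈ s, ‖UnitAddTorus.mFourierCoeff F k‖ ≤ √(4 * π * (√A * √B)) := fun s => by
    rw [← Finset.sum_erase s (a := 0) (by rw [h0, norm_zero])]
    refine le_sqrt_of_sq_le (sq_sum_le_of_lattice _ (Finset.notMem_erase 0 s) _ ?_ ?_)
    · exact (bessel_torus F _).trans_eq hA
    · simp only [← hnorm]
      exact (bessel_torus G _).trans_eq hB
  have hs : Summable fun k => ‖UnitAddTorus.mFourierCoeff F k‖ :=
    summable_of_sum_le (fun _ => norm_nonneg _) hsum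
  have hF := UnitAddTorus.hasSum_mFourier_series_apply_of_summable hs.of_norm t
  have hle : ‖F t‖ ≤ √(4 * π * (√A * √B)) := by
    refine hF.norm_le_of_bounded hs.hasSum (fun k => ?_) |>.trans (hs.tsum_le_of_sum_le hsum)
    rw [norm_smul]
    refine mul_le_of_le_one_right (norm_nonneg _) ?_
    exact ((UnitAddTorus.mFourier k).norm_coe_le_norm t).trans_eq UnitAddTorus.mFourier_norm
  calc ‖F t‖ ^ 2 ≤ √(4 * π * (√A * √B)) ^ 2 := by gcongr
    _ = _ := sq_sqrt (by positivity)

theorem agmon_square_torus_vector_pointwise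
    {u1 u2 : ℝ × ℝ → ℝ}
    (hsmooth1 : ContDiff ℝ (⊤ : ℕ∞) u1) (hsmooth2 : ContDiff ℝ (⊤ : ℕ∞) u2)
    (hper11 : ∀ p : ℝ × ℝ, u1 (p.1 + 2 * π, p.2) = u1 p)
    (hper12 : ∀ p : ℝ × ℝ, u1 (p.1, p.2 + 2 * π) = u1 p)
    (hper21 : ∀ p : ℝ × ℝ, u2 (p.1 + 2 * π, p.2) = u2 p)
    (hper22 : ∀ p : ℝ × ℝ, u2 (p.1, p.2 + 2 * π) = u2 p)
    (hmean1 : (∫ p in cell2, u1 p) = 0)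
    (hmean2 : (∫ p in cell2, u2 p) = 0) (p : ℝ × ℝ) :
    (u1 p) ^ 2 + (u2 p) ^ 2 ≤
      (1 / π) * √(∫ p in cell2, ((u1 p) ^ 2 + (u2 p) ^ 2)) *
        √(∫ p in cell2, ((lap u1 p) ^ 2 + (lap u2 p) ^ 2)) := by
  have hc1 := hsmooth1.continuous
  have hc2 := hsmooth2.continuous
  have hl1 := continuous_lap hsmooth1
  have hl2 := continuous_lap hsmooth2
  have hf : Continuous fun p => (u1 p : ℂ) + u2 p * Complex.I := by fun_prop
  have hg : Continuous fun p => (lap u1 p : ℂ) + lap u2 p * Complex.I := by fun_prop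
  obtain ⟨F, hF⟩ := exists_torus_lift hf (fun p => by rw [hper11, hper21])
    (fun p => by rw [hper12, hper22])
  obtain ⟨G, hG⟩ := exists_torus_lift hg
    (fun p => by rw [lap_add_fst hper11, lap_add_fst hper21])
    (fun p => by rw [lap_add_snd hper12, lap_add_snd hper22])
  have hnorm : ∀ a b : ℝ, ‖(a : ℂ) + b * Complex.I‖ ^ 2 = a ^ 2 + b ^ 2 := fun a b => by
    rw [Complex.sq_norm, Complex.normSq_add_mul_I]
  have key := sq_norm_le_of_mFourierCoeff F G
    (integral_torus (fun t => ‖F t‖ ^ 2) (fun p => u1 p ^ 2 + u2 p ^ 2) (by fun_prop)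
      (fun p => by rw [hF, hnorm]))
    (integral_torus (fun t => ‖G t‖ ^ 2) (fun p => lap u1 p ^ 2 + lap u2 p ^ 2) (by fun_prop)
      (fun p => by rw [hG, hnorm])) ?_ ?_ (torusMk p)
  · rw [hF, hnorm] at key
    refine key.trans_eq ?_
    rw [smul_eq_mul, smul_eq_mul, sqrt_mul (by positivity), sqrt_mul (by positivity), sqrt_inv,
      sqrt_sq (by positivity)]
    have := pi_ne_zero
    field_simp
    ring
  · rw [mFourierCoeff_eq_setIntegral F hf hF, setIntegral_waveConj_mul_add hc1 hc2]
    have hw : waveConj 0 = 1 := by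
      ext p
      simp [waveConj]
    simp [hw, integral_complex_ofReal, hmean1, hmean2]
  · intro k
    rw [mFourierCoeff_eq_setIntegral F hf hF, mFourierCoeff_eq_setIntegral G hg hG,
      setIntegral_waveConj_mul_add hc1 hc2, setIntegral_waveConj_mul_add hl1 hl2,
      integral_lap_mul_waveConj hsmooth1 hper11 hper12,
      integral_lap_mul_waveConj hsmooth2 hper21 hper22, Complex.real_smul, Complex.real_smul]
    ring

/-- Vector-valued Agmon inequality on the square torus, for a vector field
`u = (u¹, u²)` with the Euclidean norm `|u(x)|² = u¹(x)² + u²(x)²`: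
`‖u‖_∞² ≤ (1/π) ‖u‖ ‖Δu‖`, where `Δu` acts componentwise. -/
theorem agmon_square_torus_vector
    (u1 u2 : ℝ × ℝ → ℝ)
    (hsmooth1 : ContDiff ℝ (⊤ : ℕ∞) u1) (hsmooth2 : ContDiff ℝ (⊤ : ℕ∞) u2)
    (hper11 : ∀ p : ℝ × ℝ, u1 (p.1 + 2 * π, p.2) = u1 p)
    (hper12 : ∀ p : ℝ × ℝ, u1 (p.1, p.2 + 2 * π) = u1 p)
    (hper21 : ∀ p : ℝ × ℝ, u2 (p.1 + 2 * π, p.2) = u2 p)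
    (hper22 : ∀ p : ℝ × ℝ, u2 (p.1, p.2 + 2 * π) = u2 p)
    (hmean1 : (∫ p in cell2, u1 p) = 0)
    (hmean2 : (∫ p in cell2, u2 p) = 0) :
    (⨆ p ∈ cell2, Real.sqrt ((u1 p) ^ 2 + (u2 p) ^ 2)) ^ 2 ≤
      (1 / π) * Real.sqrt (∫ p in cell2, ((u1 p) ^ 2 + (u2 p) ^ 2)) *
        Real.sqrt (∫ p in cell2, ((lap u1 p) ^ 2 + (lap u2 p) ^ 2)) := by
  have hpt := agmon_square_torus_vector_pointwise hsmooth1 hsmooth2 hper11 hper12 hper21 hper22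
    hmean1 hmean2
  set M := (1 / π) * √(∫ p in cell2, ((u1 p) ^ 2 + (u2 p) ^ 2)) *
    √(∫ p in cell2, ((lap u1 p) ^ 2 + (lap u2 p) ^ 2)) with hM
  have hM0 : 0 ≤ M := by positivity
  have hsup : (⨆ p ∈ cell2, √((u1 p) ^ 2 + (u2 p) ^ 2)) ≤ √M :=
    Real.iSup_le (fun p => Real.iSup_le (fun _ => sqrt_le_sqrt (hpt p)) (sqrt_nonneg _))
      (sqrt_nonneg _)
  have hnonneg : 0 ≤ ⨆ p ∈ cell2, √((u1 p) ^ 2 + (u2 p) ^ 2) :=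
    Real.iSup_nonneg fun p => Real.iSup_nonneg fun _ => sqrt_nonneg _
  calc _ ≤ √M ^ 2 := by gcongr
    _ = M := sq_sqrt hM0
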